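/- With the notation of the coding construction (irrational θ₀, partition with t_m ≡ −θ₀, digit map E on 𝔇₀, T(x) = d·x mod 1): let X₀ = E(𝔇₀) and X = closure(X₀). Then (X, T) is an infinite rotational subset of 𝕋: X is closed, T-invariant, minimal, and T|_X preserves cyclic order; moreover (𝕋, rotation by θ₀) is a factor of (X,T). -/

import Mathlib

open Set Filter MeasureTheory

noncomputable def rep (z : UnitAddCircle) : ℝ := (AddCircle.equivIco 1 0 z : ℝ)
def MinimalOn (T : UnitAddCircle → UnitAddCircle) (X : Set UnitAddCircle) : Prop :=
  ∀ x ∈ X, ∀ y ∈ X, y ∈ closure {z : UnitAddCircle | ∃ n : ℕ, T^[n] x = z}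

def PreservesCyclicOrder (T : UnitAddCircle → UnitAddCircle) (X : Set UnitAddCircle) : Prop :=
  ∀ p ∈ X, ∀ q ∈ X, ∀ r ∈ X,
    T p ≠ T q → T q ≠ T r → T r ≠ T p →
    sbtw p q r → sbtw (T p) (T q) (T r)

def IsRotational (T : UnitAddCircle → UnitAddCircle) (X : Set UnitAddCircle) : Prop :=
  IsClosed X ∧ Set.MapsTo T X X ∧ MinimalOn T X ∧ PreservesCyclicOrder T X


open Topology

lemma rep_coe (x : ℝ) : rep (x : UnitAddCircle) = Int.fract x := by
  simp [rep]

lemma coe_rep (z : UnitAddCircle) : ((rep z : ℝ) : UnitAddCircle) = z :=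
  AddCircle.coe_equivIco (p := (1:ℝ)) (a := 0)

lemma rep_nonneg (z : UnitAddCircle) : 0 ≤ rep z := (AddCircle.equivIco 1 0 z).2.1

lemma rep_lt_one (z : UnitAddCircle) : rep z < 1 := by
  have := (AddCircle.equivIco 1 0 z).2.2
  simpa [rep] using this

lemma rep_continuousAt {z : UnitAddCircle} (hz : z ≠ 0) : ContinuousAt rep z := by
  have h := AddCircle.continuousAt_equivIco (1:ℝ) 0 (x := z) (by simpa using hz)
  exact continuousAt_subtype_val.comp h

lemma ne_zero_of_rep_pos {z : UnitAddCircle} (hz : 0 < rep z) : z ≠ 0 := by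
  rintro rfl
  have := rep_coe 0
  simp at this
  linarith

lemma coe_fract (x : ℝ) : ((Int.fract x : ℝ) : UnitAddCircle) = (x : UnitAddCircle) := by
  rw [← rep_coe, coe_rep]

lemma coe_eq_coe_iff_fract (x y : ℝ) :
    (x : UnitAddCircle) = (y : UnitAddCircle) ↔ Int.fract x = Int.fract y := by
  constructor
  · intro h
    rw [← rep_coe, ← rep_coe, h]
  · intro h
    rw [← coe_fract x, ← coe_fract y, h]

lemma sbtw_iff_rep (p q r : UnitAddCircle) :
    sbtw p q r ↔ 0 < rep (q - p) ∧ rep (q - p) < rep (r - p) := by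
  have h1 : sbtw p q r ↔ ¬ btw r q p := sbtw_iff_not_btw
  have h2 : btw r q p ↔ btw p r q := btw_cyclic
  rw [h1, h2]
  induction p using QuotientAddGroup.induction_on with | H x
  induction q using QuotientAddGroup.induction_on with | H y
  induction r using QuotientAddGroup.induction_on with | H z
  have h3 := QuotientAddGroup.btw_coe_iff' (p := (1:ℝ)) (x₁ := x) (x₂ := z) (x₃ := y)
  have e1 : rep ((y : UnitAddCircle) - (x : UnitAddCircle)) = Int.fract (y - x) := by
    rw [← rep_coe]; rfl
  have e2 : rep ((z : UnitAddCircle) - (x : UnitAddCircle)) = Int.fract (z - x) := by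
    rw [← rep_coe]; rfl
  have e3 : toIcoMod (zero_lt_one' ℝ) 0 (z - x) = Int.fract (z - x) := toIcoMod_zero_one _
  have e4 := toIocMod_eq_sub_fract_mul (zero_lt_one' ℝ) 0 (y - x)
  have e5 : Int.fract ((0 + 1 - (y-x)) / 1) = Int.fract (-(y-x)) := by
    rw [← Int.fract_add_one (-(y-x))]; congr 1; ring
  change ¬ (btw ((x : ℝ ⧸ AddSubgroup.zmultiples (1:ℝ))) z y) ↔ 0 < rep ((y : UnitAddCircle) - (x : UnitAddCircle)) ∧ rep ((y : UnitAddCircle) - (x : UnitAddCircle)) < rep ((z : UnitAddCircle) - (x : UnitAddCircle))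
  rw [h3, e1, e2]
  rw [show toIcoMod _ 0 (z - x) = Int.fract (z - x) from e3,
    show toIocMod _ 0 (y - x) = _ from e4, e5]
  by_cases hu : Int.fract (y - x) = 0
  · have : Int.fract (-(y - x)) = 0 := Int.fract_neg_eq_zero.2 hu
    rw [this, hu]
    have := (Int.fract_lt_one (z - x)).le
    simp [this]
  · rw [Int.fract_neg hu]
    have h0 : 0 < Int.fract (y - x) := lt_of_le_of_ne (Int.fract_nonneg _) (Ne.symm hu)
    constructor
    · intro h
      refine ⟨h0, ?_⟩
      by_contra hc
      apply h
      push Not at hc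
      linarith
    · rintro ⟨_, h⟩ hc
      linarith

def cyc (x y z : ℝ) : Prop := (x < y ∧ y < z) ∨ (y < z ∧ z < x) ∨ (z < x ∧ x < y)

lemma fract_sub_of_mem {x y : ℝ} (hx : x ∈ Ioo (0:ℝ) 1) (hy : y ∈ Ioo (0:ℝ) 1) :
    (x ≤ y ∧ Int.fract (y - x) = y - x) ∨ (y < x ∧ Int.fract (y - x) = y - x + 1) := by
  rcases le_or_gt x y with h | h
  · left
    refine ⟨h, Int.fract_eq_self.2 ⟨by linarith, by linarith [hx.1, hy.2]⟩⟩
  · right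
    refine ⟨h, ?_⟩
    rw [← Int.fract_add_one, Int.fract_eq_self]
    exact ⟨by linarith [hx.2, hy.1], by linarith⟩

lemma sbtw_coe_iff_cyc {x y z : ℝ} (hx : x ∈ Ioo (0:ℝ) 1) (hy : y ∈ Ioo (0:ℝ) 1)
    (hz : z ∈ Ioo (0:ℝ) 1) :
    sbtw (x : UnitAddCircle) (y : UnitAddCircle) (z : UnitAddCircle) ↔ cyc x y z := by
  rw [sbtw_iff_rep, ← AddCircle.coe_sub, ← AddCircle.coe_sub, rep_coe, rep_coe]
  unfold cyc
  have := hx.1; have := hx.2; have := hy.1; have := hy.2; have := hz.1; have := hz.2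
  rcases fract_sub_of_mem hx hy with ⟨h1, h2⟩ | ⟨h1, h2⟩ <;>
  rcases fract_sub_of_mem hx hz with ⟨h3, h4⟩ | ⟨h3, h4⟩ <;> rw [h2, h4] <;> grind

lemma sbtw_add_right (p q r c : UnitAddCircle) :
    sbtw (p + c) (q + c) (r + c) ↔ sbtw p q r := by
  simp [sbtw_iff_rep]

lemma isOpen_sbtw : IsOpen {w : UnitAddCircle × UnitAddCircle × UnitAddCircle |
    sbtw w.1 w.2.1 w.2.2} := by
  rw [isOpen_iff_mem_nhds]
  rintro ⟨p, q, r⟩ h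
  simp only [mem_ofPred_eq, sbtw_iff_rep] at h
  have c1 : ContinuousAt (fun w : UnitAddCircle × UnitAddCircle × UnitAddCircle =>
      rep (w.2.1 - w.1)) (p, q, r) :=
    ContinuousAt.comp (g := rep) (rep_continuousAt (ne_zero_of_rep_pos h.1))
      (by fun_prop)
  have c2 : ContinuousAt (fun w : UnitAddCircle × UnitAddCircle × UnitAddCircle =>
      rep (w.2.2 - w.1)) (p, q, r) :=
    ContinuousAt.comp (g := rep) (rep_continuousAt (ne_zero_of_rep_pos (h.1.trans h.2)))
      (by fun_prop)
  have e1 := c1.eventually (lt_mem_nhds h.1)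
  have e2 := c1.eventually_lt c2 h.2
  filter_upwards [e1, e2] with w h1 h2
  simp only [mem_ofPred_eq, sbtw_iff_rep]
  exact ⟨h1, h2⟩

lemma isClosed_btw : IsClosed {w : UnitAddCircle × UnitAddCircle × UnitAddCircle |
    btw w.1 w.2.1 w.2.2} := by
  rw [← isOpen_compl_iff]
  have : {w : UnitAddCircle × UnitAddCircle × UnitAddCircle |
      btw w.1 w.2.1 w.2.2}ᶜ = (fun w : UnitAddCircle × UnitAddCircle × UnitAddCircle =>
        (w.2.2, w.2.1, w.1)) ⁻¹' {w | sbtw w.1 w.2.1 w.2.2} := by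
    ext w
    simp only [mem_compl_iff, mem_ofPred_eq, mem_preimage]
    exact sbtw_iff_not_btw.symm
  rw [this]
  exact isOpen_sbtw.preimage (by fun_prop)

lemma dense_rot {θ₀ : ℝ} (hθ : Irrational θ₀) (c : UnitAddCircle) {W : Set UnitAddCircle}
    (hW : IsOpen W) (hne : W.Nonempty) :
    ∃ n : ℕ, c + n • (θ₀ : UnitAddCircle) ∈ W := by
  have h1 : DenseRange (· • (θ₀ : UnitAddCircle) : ℤ → UnitAddCircle) :=
    AddCircle.denseRange_zsmul_coe_iff.2 (by simpa using hθ)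
  have h2 : DenseRange (· • (θ₀ : UnitAddCircle) : ℕ → UnitAddCircle) :=
    denseRange_zsmul_iff_nsmul.1 h1
  obtain ⟨w, hw⟩ := hne
  obtain ⟨n, hn⟩ := h2.exists_mem_open (s := (fun z => c + z) ⁻¹' W)
    (hW.preimage (by fun_prop)) ⟨w - c, by simpa using hw⟩
  exact ⟨n, hn⟩

lemma coe_add_nat_mul (ω θ₀ : ℝ) (n : ℕ) :
    ((ω + n * θ₀ : ℝ) : UnitAddCircle) = (ω : UnitAddCircle) + n • (θ₀ : UnitAddCircle) := by
  rw [← nsmul_eq_mul]; simp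

lemma dense_fract {θ₀ : ℝ} (hθ : Irrational θ₀) (ω a b : ℝ) (ha : 0 ≤ a) (hab : a < b)
    (hb : b ≤ 1) : ∃ n : ℕ, Int.fract (ω + n * θ₀) ∈ Ioo a b := by
  have hopen : IsOpen (rep ⁻¹' Ioo a b) := by
    rw [isOpen_iff_mem_nhds]
    intro z hz
    exact (rep_continuousAt (ne_zero_of_rep_pos (lt_of_le_of_lt ha hz.1))).preimage_mem_nhds
      (isOpen_Ioo.mem_nhds hz)
  have hne : (rep ⁻¹' Ioo a b).Nonempty := by
    refine ⟨(((a + b) / 2 : ℝ) : UnitAddCircle), ?_⟩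
    simp only [mem_preimage, rep_coe]
    rw [Int.fract_eq_self.2 ⟨by linarith, by linarith⟩]
    exact ⟨by linarith, by linarith⟩
  obtain ⟨n, hn⟩ := dense_rot hθ (ω : UnitAddCircle) hopen hne
  refine ⟨n, ?_⟩
  rw [← coe_add_nat_mul] at hn
  simpa only [mem_preimage, rep_coe] using hn

/-- The monotone degree one map inverting `E`. -/
noncomputable def liftF (D : Set ℝ) (E : ℝ → ℝ) (y : ℝ) : ℝ :=
  sSup {s | ∃ ω ∈ D, ∃ n : ℤ, s = ω + n ∧ E ω + n ≤ y}

section layer2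
variable {D : Set ℝ} {E : ℝ → ℝ}

lemma liftF_nonempty (hne : D.Nonempty) (y : ℝ) :
    {s | ∃ ω ∈ D, ∃ n : ℤ, s = ω + n ∧ E ω + n ≤ y}.Nonempty := by
  obtain ⟨ω, hω⟩ := hne
  refine ⟨_, ω, hω, ⌊y - E ω⌋, rfl, ?_⟩
  linarith [Int.floor_le (y - E ω)]

lemma liftF_bdd (hD1 : D ⊆ Ioo 0 1) (hEI : ∀ ω ∈ D, E ω ∈ Ioo (0:ℝ) 1) (y : ℝ) :
    BddAbove {s | ∃ ω ∈ D, ∃ n : ℤ, s = ω + n ∧ E ω + n ≤ y} := by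
  refine ⟨y + 1, ?_⟩
  rintro s ⟨ω, hω, n, rfl, h⟩
  linarith [(hD1 hω).2, (hEI ω hω).1]

lemma liftF_mono (hne : D.Nonempty) (hD1 : D ⊆ Ioo 0 1) (hEI : ∀ ω ∈ D, E ω ∈ Ioo (0:ℝ) 1) :
    Monotone (liftF D E) := by
  intro y y' hy
  apply csSup_le_csSup (liftF_bdd hD1 hEI y') (liftF_nonempty hne y)
  rintro s ⟨ω, hω, n, rfl, h⟩
  exact ⟨ω, hω, n, rfl, h.trans hy⟩

lemma liftF_E (hD1 : D ⊆ Ioo 0 1) (hEI : ∀ ω ∈ D, E ω ∈ Ioo (0:ℝ) 1)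
    (hEm : StrictMonoOn E D) {ω : ℝ} (hω : ω ∈ D) (n : ℤ) :
    liftF D E (E ω + n) = ω + n := by
  apply IsGreatest.csSup_eq
  refine ⟨⟨ω, hω, n, rfl, le_rfl⟩, ?_⟩
  rintro s ⟨ω', hω', n', rfl, h⟩
  have h1 := hEI ω hω
  have h2 := hEI ω' hω'
  have h3 : n' < n + 1 := by
    have : (n' : ℝ) < n + 1 := by linarith [h1.2, h2.1]
    exact_mod_cast this
  rcases eq_or_lt_of_le (Int.lt_add_one_iff.1 h3) with rfl | h4
  · have : ω' ≤ ω := (hEm.le_iff_le hω' hω).1 (by linarith)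
    linarith
  · have : (n' : ℝ) + 1 ≤ n := by exact_mod_cast h4
    linarith [(hD1 hω).1, (hD1 hω').2]

lemma liftF_add_one (hne : D.Nonempty) (hD1 : D ⊆ Ioo 0 1)
    (hEI : ∀ ω ∈ D, E ω ∈ Ioo (0:ℝ) 1) (y : ℝ) :
    liftF D E (y + 1) = liftF D E y + 1 := by
  apply le_antisymm
  · apply csSup_le (liftF_nonempty hne _)
    rintro s ⟨ω, hω, n, rfl, h⟩
    have := le_csSup (liftF_bdd hD1 hEI y) (a := ω + ((n - 1 : ℤ) : ℝ))
      ⟨ω, hω, n - 1, rfl, by push_cast; linarith⟩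
    push_cast at this
    unfold liftF
    linarith
  · rw [← le_sub_iff_add_le]
    apply csSup_le (liftF_nonempty hne _)
    rintro s ⟨ω, hω, n, rfl, h⟩
    have := le_csSup (liftF_bdd hD1 hEI (y + 1)) (a := ω + ((n + 1 : ℤ) : ℝ))
      ⟨ω, hω, n + 1, rfl, by push_cast; linarith⟩
    push_cast at this
    unfold liftF
    linarith

lemma dense_aux {C : Set ℝ} (hC : C.Countable)
    (hDd : ∀ s, s ∉ C → Int.fract s ∈ D) (U : Set UnitAddCircle) (hU : IsOpen U)
    (hne : U.Nonempty) : ∃ ω ∈ D, (ω : UnitAddCircle) ∈ U := by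
  obtain ⟨z, hz⟩ := hne
  have hd : Dense Cᶜ := hC.dense_compl ℝ
  obtain ⟨s, hs, hsU⟩ := hd.exists_mem_open (U := (fun r : ℝ => (r : UnitAddCircle)) ⁻¹' U)
    (hU.preimage (AddCircle.continuous_mk' (1:ℝ))) ⟨rep z, by simpa [coe_rep] using hz⟩
  exact ⟨Int.fract s, hDd s hs, by rw [coe_fract]; exact hsU⟩

lemma exists_factor {C : Set ℝ} (hC : C.Countable) (hDd : ∀ s, s ∉ C → Int.fract s ∈ D)
    (hD1 : D ⊆ Ioo 0 1) (hEI : ∀ ω ∈ D, E ω ∈ Ioo (0:ℝ) 1) (hEm : StrictMonoOn E D) :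
    ∃ Φ : UnitAddCircle → UnitAddCircle, Continuous Φ ∧
      ∀ ω ∈ D, Φ (E ω : UnitAddCircle) = (ω : UnitAddCircle) := by
  have hd : Dense Cᶜ := hC.dense_compl ℝ
  have hne : D.Nonempty := by
    obtain ⟨s, hs⟩ := hd.nonempty
    exact ⟨_, hDd s hs⟩
  have hcont : Continuous (liftF D E) := by
    apply (liftF_mono hne hD1 hEI).continuous_of_denseRange
    apply hd.mono
    intro s hs
    refine ⟨E (Int.fract s) + ⌊s⌋, ?_⟩
    rw [liftF_E hD1 hEI hEm (hDd s hs)]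
    exact Int.fract_add_floor s
  have hper : Function.Periodic (fun y => ((liftF D E y : ℝ) : UnitAddCircle)) 1 := by
    intro y
    simp only [liftF_add_one hne hD1 hEI, AddCircle.coe_add]
    simp
  refine ⟨hper.lift, ?_, ?_⟩
  · exact continuous_coinduced_dom.2 ((AddCircle.continuous_mk' (1:ℝ)).comp hcont)
  · intro ω hω
    have := hper.lift_coe (E ω)
    rw [this]
    have := liftF_E hD1 hEI hEm hω 0
    simp only [Int.cast_zero, add_zero] at this
    rw [this]

theorem layer2 {d : ℕ} {θ₀ : ℝ} (hθ : Irrational θ₀)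
    {C : Set ℝ} (hC : C.Countable) (hDd : ∀ s, s ∉ C → Int.fract s ∈ D)
    (hD1 : D ⊆ Ioo 0 1) (hEI : ∀ ω ∈ D, E ω ∈ Ioo (0:ℝ) 1) (hEm : StrictMonoOn E D)
    (hτ : ∀ ω ∈ D, Int.fract (ω + θ₀) ∈ D)
    (hET : ∀ ω ∈ D, d • (E ω : UnitAddCircle) = (E (Int.fract (ω + θ₀)) : UnitAddCircle))
    (hEc : ∀ ω ∈ D, ∀ ε > 0, ∀ᶠ z in 𝓝 (ω : UnitAddCircle), ∀ ω' ∈ D,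
      (ω' : UnitAddCircle) = z → |E ω' - E ω| ≤ ε)
    (T : UnitAddCircle → UnitAddCircle) (hTdef : ∀ x : UnitAddCircle, T x = d • x)
    (X : Set UnitAddCircle)
    (hX : X = closure ((fun r : ℝ => ((r : ℝ) : UnitAddCircle)) '' (E '' D))) :
    X.Infinite ∧ IsRotational T X ∧
      ∃ Φ : UnitAddCircle → UnitAddCircle,
        ContinuousOn Φ X ∧ Φ '' X = Set.univ ∧
        ∀ x ∈ X, Φ (T x) = Φ x + ((θ₀ : ℝ) : UnitAddCircle) := by
  obtain ⟨Φ, hΦ, hΦE⟩ := exists_factor hC hDd hD1 hEI hEm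
  set X₀ : Set UnitAddCircle := (fun r : ℝ => ((r : ℝ) : UnitAddCircle)) '' (E '' D) with hX₀
  have hTc : Continuous T := by
    have : T = fun x => d • x := funext hTdef
    rw [this]; fun_prop
  have hXcl : IsClosed X := hX ▸ isClosed_closure
  have hsub : X₀ ⊆ X := hX ▸ subset_closure
  have hmaps₀ : MapsTo T X₀ X₀ := by
    rintro _ ⟨_, ⟨ω, hω, rfl⟩, rfl⟩
    exact ⟨_, ⟨_, hτ ω hω, rfl⟩, by simp only [hTdef]; exact (hET ω hω).symm⟩
  have hmaps : MapsTo T X X := by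
    rw [hX]; exact hmaps₀.closure hTc
  have hfac : ∀ x ∈ X, Φ (T x) = Φ x + ((θ₀ : ℝ) : UnitAddCircle) := by
    have hcl : IsClosed {x | Φ (T x) = Φ x + ((θ₀ : ℝ) : UnitAddCircle)} :=
      isClosed_eq (hΦ.comp hTc) (by fun_prop)
    have : X ⊆ {x | Φ (T x) = Φ x + ((θ₀ : ℝ) : UnitAddCircle)} := by
      rw [hX]
      apply closure_minimal _ hcl
      rintro _ ⟨_, ⟨ω, hω, rfl⟩, rfl⟩
      change Φ (T (E ω : UnitAddCircle)) = Φ (E ω : UnitAddCircle) + _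
      rw [hTdef, hET ω hω, hΦE _ (hτ ω hω), hΦE ω hω, coe_fract, AddCircle.coe_add]
    exact this
  have hsurj : Φ '' X = Set.univ := by
    have hcl : IsClosed (Φ '' X) := (hXcl.isCompact.image hΦ).isClosed
    have hdense : Dense (Φ '' X) := by
      rw [dense_iff_inter_open]
      intro U hU hne
      obtain ⟨ω, hω, h⟩ := dense_aux hC hDd U hU hne
      exact ⟨_, h, _, hsub ⟨_, ⟨ω, hω, rfl⟩, rfl⟩, hΦE ω hω⟩
    rw [← hcl.closure_eq, hdense.closure_eq]
  have hinf : X.Infinite := by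
    intro hfin
    have h1 := hfin.image Φ
    rw [hsurj] at h1
    have h2 : Infinite UnitAddCircle := by
      have : Infinite (Ico (0:ℝ) (0 + 1)) := by
        rw [Set.infinite_coe_iff]; exact Ico_infinite (by norm_num)
      exact (AddCircle.equivIco (1:ℝ) 0).infinite_iff.2 this
    exact Set.infinite_univ h1
  refine ⟨hinf, ⟨hXcl, hmaps, ?_, ?_⟩, Φ, hΦ.continuousOn, hsurj, hfac⟩
  · -- minimality
    intro x hx
    have hiter : ∀ n : ℕ, T^[n] x ∈ X ∧ Φ (T^[n] x) = Φ x + n • (θ₀ : UnitAddCircle) := by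
      intro n
      induction n with
      | zero => simp [hx]
      | succ n ih =>
        rw [Function.iterate_succ_apply']
        refine ⟨hmaps ih.1, ?_⟩
        rw [hfac _ ih.1, ih.2, succ_nsmul, add_assoc]
    have key : X ⊆ closure {z : UnitAddCircle | ∃ n : ℕ, T^[n] x = z} := by
      rw [hX]
      apply closure_minimal _ isClosed_closure
      rintro _ ⟨_, ⟨ω, hω, rfl⟩, rfl⟩
      rw [Metric.mem_closure_iff]
      intro ε hε
      obtain ⟨W, hW, hWo, hωW⟩ := eventually_nhds_iff.1 (hEc ω hω (ε / 2) (by linarith))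
      obtain ⟨n, hn⟩ := dense_rot hθ (Φ x) hWo ⟨_, hωW⟩
      rw [← (hiter n).2] at hn
      refine ⟨_, ⟨n, rfl⟩, ?_⟩
      have hmem : T^[n] x ∈ closure (X₀ ∩ Φ ⁻¹' W) := by
        have h1 : T^[n] x ∈ closure X₀ := hX ▸ (hiter n).1
        have h2 := (hWo.preimage hΦ).inter_closure (t := X₀) ⟨hn, h1⟩
        rwa [inter_comm] at h2
      have hsub2 : closure (X₀ ∩ Φ ⁻¹' W) ⊆ Metric.closedBall (E ω : UnitAddCircle) (ε / 2) := by
        apply closure_minimal _ Metric.isClosed_closedBall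
        rintro _ ⟨⟨_, ⟨ω', hω', rfl⟩, rfl⟩, h⟩
        simp only [mem_preimage, hΦE ω' hω'] at h
        have h3 := hW _ h ω' hω' rfl
        rw [Metric.mem_closedBall, dist_eq_norm, ← AddCircle.coe_sub]
        refine le_trans ?_ h3
        exact QuotientAddGroup.norm_mk_le_norm
      have := hsub2 hmem
      rw [Metric.mem_closedBall, dist_comm] at this
      change dist (E ω : UnitAddCircle) _ < ε
      linarith
    exact fun y hy => key hy
  · -- cyclic order
    intro p hp q hq r hr hpq hqr hrp hs
    have hcyc : ∀ a ∈ D, ∀ b ∈ D, ∀ c ∈ D, (cyc (E a) (E b) (E c) ↔ cyc a b c) := by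
      intro a ha b hb c hc
      unfold cyc
      rw [hEm.lt_iff_lt ha hb, hEm.lt_iff_lt hb hc, hEm.lt_iff_lt hc ha]
    have h0 : ∀ p ∈ X₀, ∀ q ∈ X₀, ∀ r ∈ X₀, sbtw p q r → sbtw (T p) (T q) (T r) := by
      rintro _ ⟨_, ⟨a, ha, rfl⟩, rfl⟩ _ ⟨_, ⟨b, hb, rfl⟩, rfl⟩ _ ⟨_, ⟨c, hc, rfl⟩, rfl⟩
      simp only [hTdef]
      rw [hET a ha, hET b hb, hET c hc, sbtw_coe_iff_cyc (hEI a ha) (hEI b hb) (hEI c hc),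
        sbtw_coe_iff_cyc (hEI _ (hτ a ha)) (hEI _ (hτ b hb)) (hEI _ (hτ c hc)),
        hcyc a ha b hb c hc, hcyc _ (hτ a ha) _ (hτ b hb) _ (hτ c hc),
        ← sbtw_coe_iff_cyc (hD1 ha) (hD1 hb) (hD1 hc),
        ← sbtw_coe_iff_cyc (hD1 (hτ a ha)) (hD1 (hτ b hb)) (hD1 (hτ c hc)),
        coe_fract, coe_fract, coe_fract, AddCircle.coe_add, AddCircle.coe_add, AddCircle.coe_add,
        sbtw_add_right]
      exact id
    have hmem : (p, q, r) ∈ closure ({w : UnitAddCircle × UnitAddCircle × UnitAddCircle |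
        sbtw w.1 w.2.1 w.2.2} ∩ X₀ ×ˢ (X₀ ×ˢ X₀)) := by
      apply isOpen_sbtw.inter_closure
      refine ⟨hs, ?_⟩
      rw [closure_prod_eq, closure_prod_eq, ← hX]
      exact ⟨hp, hq, hr⟩
    have hcl : IsClosed ((fun w : UnitAddCircle × UnitAddCircle × UnitAddCircle =>
        (T w.1, T w.2.1, T w.2.2)) ⁻¹' {w | btw w.1 w.2.1 w.2.2}) :=
      isClosed_btw.preimage (by fun_prop)
    have hb : btw (T p) (T q) (T r) := by
      refine closure_minimal ?_ hcl hmem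
      rintro ⟨a, b, c⟩ ⟨h1, h2, h3, h4⟩
      exact (h0 a h2 b h3 c h4 h1).btw
    rw [sbtw_iff_not_btw]
    intro hb'
    rcases btw_antisymm hb hb' with h | h | h
    · exact hpq h
    · exact hqr h
    · exact hrp h

end layer2

section digits
variable {d : ℕ} {a : ℕ → ℕ}

lemma hasSum_one (hd : 2 ≤ d) : HasSum (fun n : ℕ => ((d : ℝ) - 1) / d ^ (n + 1)) 1 := by
  have hd' : (2:ℝ) ≤ d := by exact_mod_cast hd
  have h := (hasSum_geometric_of_lt_one (r := (1:ℝ) / d) (by positivity)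
    (by rw [div_lt_one (by linarith)]; linarith)).mul_left (((d : ℝ) - 1) / d)
  have e : ((d : ℝ) - 1) / d * (1 - 1 / (d:ℝ))⁻¹ = 1 := by
    have : (d : ℝ) - 1 ≠ 0 := by linarith
    have : (d : ℝ) ≠ 0 := by linarith
    field_simp
  rw [e] at h
  have hfun : (fun n : ℕ => ((d : ℝ) - 1) / d ^ (n + 1)) =
      fun n : ℕ => ((d : ℝ) - 1) / d * (1 / (d : ℝ)) ^ n := by
    funext n
    rw [div_pow, one_pow, pow_succ, div_mul_div_comm, mul_one, mul_comm (d : ℝ)]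
  rw [hfun]
  exact h

lemma dig_le (hd : 2 ≤ d) (ha : ∀ n, a n ≤ d - 1) (n : ℕ) :
    (a n : ℝ) / d ^ (n + 1) ≤ ((d : ℝ) - 1) / d ^ (n + 1) := by
  have : (a n : ℝ) ≤ d - 1 := by
    have h : a n + 1 ≤ d := by have := ha n; omega
    have : (a n : ℝ) + 1 ≤ d := by exact_mod_cast h
    linarith
  gcongr

lemma dig_summable (hd : 2 ≤ d) (ha : ∀ n, a n ≤ d - 1) :
    Summable (fun n : ℕ => (a n : ℝ) / d ^ (n + 1)) :=
  Summable.of_nonneg_of_le (fun n => by positivity) (dig_le hd ha) (hasSum_one hd).summable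

lemma dig_rec (hd : 2 ≤ d) (ha : ∀ n, a n ≤ d - 1) :
    ∑' n : ℕ, (a n : ℝ) / d ^ (n + 1) = (a 0 + ∑' n : ℕ, (a (n + 1) : ℝ) / d ^ (n + 1)) / d := by
  rw [(dig_summable hd ha).tsum_eq_zero_add, add_div, ← tsum_div_const]
  congr 1
  · simp
  · apply tsum_congr
    intro n
    rw [pow_succ (d:ℝ) (n+1), div_div]

lemma dig_pos (hd : 2 ≤ d) (ha : ∀ n, a n ≤ d - 1) (h : ∃ n, 0 < a n) :
    0 < ∑' n : ℕ, (a n : ℝ) / d ^ (n + 1) := by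
  obtain ⟨n, hn⟩ := h
  have : (0:ℝ) < a n := by exact_mod_cast hn
  exact (dig_summable hd ha).tsum_pos (fun n => by positivity) n (by positivity)

lemma dig_lt_one (hd : 2 ≤ d) (ha : ∀ n, a n ≤ d - 1) (h : ∃ n, a n < d - 1) :
    ∑' n : ℕ, (a n : ℝ) / d ^ (n + 1) < 1 := by
  obtain ⟨n, hn⟩ := h
  rw [← (hasSum_one hd).tsum_eq]
  refine Summable.tsum_lt_tsum (i := n) (dig_le hd ha) ?_ (dig_summable hd ha) (hasSum_one hd).summable
  have : (a n : ℝ) < d - 1 := by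
    have h : a n + 1 < d := by omega
    have : (a n : ℝ) + 1 < d := by exact_mod_cast h
    linarith
  gcongr

end digits

lemma interval_exists {ℓ : ℕ} {t : Fin (ℓ + 1) → ℝ} (ht0 : t 0 = 0) (ht1 : t (Fin.last ℓ) = 1)
    {y : ℝ} (hy : 0 ≤ y) (hy1 : y < 1) (hne : ∀ i, y ≠ t i) :
    ∃ i : Fin ℓ, y ∈ Ioo (t i.castSucc) (t i.succ) := by
  by_contra! hc
  have : ∀ i, t i < y := by
    intro i
    induction i using Fin.induction with
    | zero => exact lt_of_le_of_ne (ht0 ▸ hy) (hne 0).symm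
    | succ i ih =>
      have h := hc i
      simp only [mem_Ioo, not_and, not_lt] at h
      exact lt_of_le_of_ne (h ih) (hne _).symm
  have := this (Fin.last ℓ)
  linarith

lemma fract_fract_add (x y : ℝ) : Int.fract (Int.fract x + y) = Int.fract (x + y) := by
  rw [← coe_eq_coe_iff_fract, AddCircle.coe_add, coe_fract, AddCircle.coe_add]

theorem inverse_construction_rotational
    (d : ℕ) (hd : 2 ≤ d)
    (θ₀ : ℝ) (hθ : Irrational θ₀)
    (ℓ : ℕ) (hℓ : 0 < ℓ) (hℓd : ℓ ≤ d)
    (t : Fin (ℓ + 1) → ℝ) (hmono : StrictMono t)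
    (ht0 : t 0 = 0) (ht1 : t (Fin.last ℓ) = 1)
    (m : Fin (ℓ + 1)) (hm0 : 0 < (m : ℕ)) (hmℓ : (m : ℕ) < ℓ)
    (hmθ : ((t m : ℝ) : UnitAddCircle) = ((-θ₀ : ℝ) : UnitAddCircle))
    (k : Fin ℓ → ℕ) (hk : StrictMono k) (hkd : ∀ i : Fin ℓ, k i ≤ d - 1)
    (D : Set ℝ)
    (hD : D = {ω ∈ Set.Icc (0:ℝ) 1 | ∀ n : ℕ, ∀ i : Fin (ℓ + 1),
        ((ω + n * θ₀ : ℝ) : UnitAddCircle) ≠ ((t i : ℝ) : UnitAddCircle)})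
    (dig : ℝ → ℕ → ℕ)
    (hdig : ∀ ω ∈ D, ∀ n : ℕ, ∀ i : Fin ℓ,
        Int.fract (ω + n * θ₀) ∈ Set.Ioo (t i.castSucc) (t i.succ) → dig ω n = k i)
    (E : ℝ → ℝ)
    (hE : ∀ ω : ℝ, E ω = ∑' n : ℕ, (dig ω n : ℝ) / d ^ (n + 1))
    (T : UnitAddCircle → UnitAddCircle) (hTdef : ∀ x : UnitAddCircle, T x = d • x)
    (X : Set UnitAddCircle)
    (hX : X = closure ((fun r : ℝ => ((r : ℝ) : UnitAddCircle)) '' (E '' D))) :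
    X.Infinite ∧ IsRotational T X ∧
      ∃ Φ : UnitAddCircle → UnitAddCircle,
        ContinuousOn Φ X ∧ Φ '' X = Set.univ ∧
        ∀ x ∈ X, Φ (T x) = Φ x + ((θ₀ : ℝ) : UnitAddCircle) := by
  have htb : ∀ i, 0 ≤ t i ∧ t i ≤ 1 := fun i =>
    ⟨ht0 ▸ hmono.monotone (Fin.zero_le i), ht1 ▸ hmono.monotone (Fin.le_last i)⟩
  -- basic facts on `D`
  have hDmem : ∀ ω ∈ D, ∀ n : ℕ, ∃ i : Fin ℓ,
      Int.fract (ω + n * θ₀) ∈ Ioo (t i.castSucc) (t i.succ) ∧ dig ω n = k i := by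
    intro ω hω n
    obtain ⟨i, hi⟩ := interval_exists ht0 ht1 (Int.fract_nonneg (ω + n * θ₀))
      (Int.fract_lt_one _) (by
        intro i hi
        have h1 := hω
        rw [hD] at h1
        apply h1.2 n i
        rw [← hi, coe_fract])
    exact ⟨i, hi, hdig ω hω n i hi⟩
  have hD1 : D ⊆ Ioo 0 1 := by
    intro ω hω
    have h1 := hω
    rw [hD] at h1
    obtain ⟨⟨h2, h3⟩, h4⟩ := h1
    refine ⟨lt_of_le_of_ne h2 ?_, lt_of_le_of_ne h3 ?_⟩
    · rintro rfl
      apply h4 0 0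
      simp [ht0]
    · rintro rfl
      apply h4 0 (Fin.last ℓ)
      simp [ht1]
  have hshift : ∀ ω : ℝ, ∀ n : ℕ, Int.fract (Int.fract (ω + θ₀) + n * θ₀) =
      Int.fract (ω + (n + 1 : ℕ) * θ₀) := by
    intro ω n
    rw [fract_fract_add]
    congr 1
    push_cast
    ring
  have hτ : ∀ ω ∈ D, Int.fract (ω + θ₀) ∈ D := by
    intro ω hω
    rw [hD] at hω ⊢
    refine ⟨⟨Int.fract_nonneg _, (Int.fract_lt_one _).le⟩, ?_⟩
    intro n i
    rw [Ne, coe_eq_coe_iff_fract, hshift, ← coe_eq_coe_iff_fract]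
    exact hω.2 (n + 1) i
  have hdτ : ∀ ω ∈ D, ∀ n, dig (Int.fract (ω + θ₀)) n = dig ω (n + 1) := by
    intro ω hω n
    obtain ⟨i, hi, hi'⟩ := hDmem ω hω (n + 1)
    rw [hi']
    apply hdig _ (hτ ω hω)
    rw [hshift]
    exact hi
  have hdle : ∀ ω ∈ D, ∀ n, dig ω n ≤ d - 1 := by
    intro ω hω n
    obtain ⟨i, hi, hi'⟩ := hDmem ω hω n
    rw [hi']
    exact hkd i
  have hrec : ∀ ω ∈ D, E ω = (dig ω 0 + E (Int.fract (ω + θ₀))) / d := by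
    intro ω hω
    rw [hE, hE, dig_rec hd (hdle ω hω)]
    simp only [hdτ ω hω]
  have hd0 : (0:ℝ) < d := by
    have : (2:ℝ) ≤ d := by exact_mod_cast hd
    linarith
  -- every digit occurs
  have hocc : ∀ ω ∈ D, ∀ i : Fin ℓ, ∃ n, dig ω n = k i := by
    intro ω hω i
    obtain ⟨n, hn⟩ := dense_fract hθ ω (t i.castSucc) (t i.succ) (htb _).1
      (hmono Fin.castSucc_lt_succ) (htb _).2
    exact ⟨n, hdig ω hω n i hn⟩
  have hℓ2 : 1 < ℓ := by omega
  have hk01 : k ⟨0, by omega⟩ < k ⟨1, hℓ2⟩ := hk (by simp [Fin.lt_def])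
  have hEI : ∀ ω ∈ D, E ω ∈ Ioo (0:ℝ) 1 := by
    intro ω hω
    rw [hE]
    refine ⟨dig_pos hd (hdle ω hω) ?_, dig_lt_one hd (hdle ω hω) ?_⟩
    · obtain ⟨n, hn⟩ := hocc ω hω ⟨1, hℓ2⟩
      exact ⟨n, by omega⟩
    · obtain ⟨n, hn⟩ := hocc ω hω ⟨0, by omega⟩
      have := hkd ⟨1, hℓ2⟩
      exact ⟨n, by omega⟩
  -- lexicographic comparison
  have hlt : ∀ N : ℕ, ∀ ω ∈ D, ∀ ω' ∈ D, (∀ n < N, dig ω n = dig ω' n) →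
      dig ω N < dig ω' N → E ω < E ω' := by
    intro N
    induction N with
    | zero =>
      intro ω hω ω' hω' _ h
      rw [hrec ω hω, hrec ω' hω']
      have h1 := (hEI _ (hτ ω hω)).2
      have h2 := (hEI _ (hτ ω' hω')).1
      have h3 : (dig ω 0 : ℝ) + 1 ≤ dig ω' 0 := by exact_mod_cast h
      apply div_lt_div_of_pos_right _ hd0
      linarith
    | succ N ih =>
      intro ω hω ω' hω' h h'
      rw [hrec ω hω, hrec ω' hω', h 0 (by omega)]
      have := ih _ (hτ ω hω) _ (hτ ω' hω')
        (fun n hn => by rw [hdτ ω hω, hdτ ω' hω']; exact h _ (by omega))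
        (by rw [hdτ ω hω, hdτ ω' hω']; exact h')
      apply div_lt_div_of_pos_right _ hd0
      linarith
  have hrot : ∀ x : ℝ, Int.fract (x + θ₀) = Int.fract (x - t m) := by
    intro x
    rw [← coe_eq_coe_iff_fract, AddCircle.coe_add, AddCircle.coe_sub, hmθ, AddCircle.coe_neg]
    abel
  have hstep : ∀ i : Fin ℓ, ∀ x ∈ Ioo (t i.castSucc) (t i.succ), ∀ y ∈ Ioo (t i.castSucc) (t i.succ),
      Int.fract (y + θ₀) - Int.fract (x + θ₀) = y - x := by
    intro i x hx y hy
    have b1 := htb i.castSucc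
    have b2 := htb i.succ
    have b3 := htb m
    rw [hrot, hrot]
    rcases lt_or_ge i.castSucc m with h | h
    · have h' : t i.succ ≤ t m := hmono.monotone (by
        rw [Fin.le_def]; rw [Fin.lt_def] at h; simp at h ⊢; omega)
      rw [← Int.fract_add_one (y - t m), ← Int.fract_add_one (x - t m),
        Int.fract_eq_self.2 ⟨by linarith [hy.1], by linarith [hy.2]⟩,
        Int.fract_eq_self.2 ⟨by linarith [hx.1], by linarith [hx.2]⟩]
      ring
    · have h' : t m ≤ t i.castSucc := hmono.monotone h
      have h0 : 0 < t m := ht0 ▸ hmono (by rw [Fin.lt_def]; simpa using hm0)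
      rw [Int.fract_eq_self.2 ⟨by linarith [hy.1], by linarith [hy.2]⟩,
        Int.fract_eq_self.2 ⟨by linarith [hx.1], by linarith [hx.2]⟩]
      ring
  have hdiff : ∀ ω ∈ D, ∀ ω' ∈ D, ∀ N : ℕ, (∀ n < N, dig ω n = dig ω' n) →
      Int.fract (ω' + N * θ₀) - Int.fract (ω + N * θ₀) = ω' - ω := by
    intro ω hω ω' hω' N
    induction N with
    | zero =>
      intro _
      have h1 := hD1 hω
      have h2 := hD1 hω'
      simp only [Nat.cast_zero, zero_mul, add_zero]
      rw [Int.fract_eq_self.2 ⟨h1.1.le, h1.2⟩, Int.fract_eq_self.2 ⟨h2.1.le, h2.2⟩]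
    | succ N ih =>
      intro h
      have h1 := ih (fun n hn => h n (by omega))
      obtain ⟨i, hi, hi'⟩ := hDmem ω hω N
      obtain ⟨j, hj, hj'⟩ := hDmem ω' hω' N
      have hij : i = j := hk.injective (by rw [← hi', ← hj']; exact h N (by omega))
      subst hij
      have h2 := hstep i _ hi _ hj
      rw [fract_fract_add, fract_fract_add] at h2
      have e : ∀ z : ℝ, z + ((N + 1 : ℕ) : ℝ) * θ₀ = z + N * θ₀ + θ₀ := by
        intro z; push_cast; ring
      rw [e, e, h2, h1]
  have hEm : StrictMonoOn E D := by
    intro ω hω ω' hω' hlt'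
    have hex : ∃ N, dig ω N ≠ dig ω' N := by
      by_contra! hc
      have h1 := hD1 hω
      have h2 := hD1 hω'
      obtain ⟨n, hn⟩ := dense_fract hθ ω' 0 (ω' - ω) le_rfl (by linarith)
        (by linarith [h1.1, h2.2])
      have h3 := hdiff ω hω ω' hω' n (fun n _ => hc n)
      have h4 := Int.fract_nonneg (ω + n * θ₀)
      linarith [hn.2]
    classical
    have hmin : ∀ n < Nat.find hex, dig ω n = dig ω' n := fun n hn =>
      not_not.1 (Nat.find_min hex hn)
    apply hlt (Nat.find hex) ω hω ω' hω' hmin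
    have h3 := hdiff ω hω ω' hω' _ hmin
    have hne := Nat.find_spec hex
    obtain ⟨i, hi, hi'⟩ := hDmem ω hω (Nat.find hex)
    obtain ⟨j, hj, hj'⟩ := hDmem ω' hω' (Nat.find hex)
    rw [hi', hj'] at hne ⊢
    apply hk
    by_contra hc
    have hji : j < i := lt_of_le_of_ne (not_lt.1 hc) (fun h => hne (by rw [h]))
    have h4 : t j.succ ≤ t i.castSucc := hmono.monotone (by
      rw [Fin.le_def]; rw [Fin.lt_def] at hji; simp; omega)
    linarith [hi.1, hj.2]
  have hET : ∀ ω ∈ D, d • (E ω : UnitAddCircle) = (E (Int.fract (ω + θ₀)) : UnitAddCircle) := by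
    intro ω hω
    rw [← AddCircle.coe_nsmul, coe_eq_coe_iff_fract, nsmul_eq_mul, hrec ω hω,
      mul_div_cancel₀ _ hd0.ne', Int.fract_natCast_add]
  -- continuity
  have hdc : ∀ ω ∈ D, ∀ᶠ z in 𝓝 (ω : UnitAddCircle), ∀ ω' ∈ D,
      (ω' : UnitAddCircle) = z → dig ω' 0 = dig ω 0 := by
    intro ω hω
    obtain ⟨i, hi, hi'⟩ := hDmem ω hω 0
    have e : ∀ z : ℝ, Int.fract (z + (0:ℕ) * θ₀) = rep (z : UnitAddCircle) := by
      intro z; rw [rep_coe]; simp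
    rw [e] at hi
    have hc := rep_continuousAt (ne_zero_of_rep_pos (lt_of_le_of_lt (htb _).1 hi.1))
    filter_upwards [hc.preimage_mem_nhds (isOpen_Ioo.mem_nhds hi)] with z hz ω' hω' hz'
    rw [hi']
    apply hdig ω' hω' 0 i
    rw [e, hz']
    exact hz
  have hEcN : ∀ N : ℕ, ∀ ω ∈ D, ∀ᶠ z in 𝓝 (ω : UnitAddCircle), ∀ ω' ∈ D,
      (ω' : UnitAddCircle) = z → |E ω' - E ω| ≤ (1 / (d:ℝ)) ^ N := by
    intro N
    induction N with
    | zero =>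
      intro ω hω
      refine Eventually.of_forall fun z ω' hω' _ => ?_
      have h1 := hEI ω hω
      have h2 := hEI ω' hω'
      rw [pow_zero, abs_le]
      constructor <;> linarith [h1.1, h1.2, h2.1, h2.2]
    | succ N ih =>
      intro ω hω
      have h1 := ih _ (hτ ω hω)
      have hc : Tendsto (fun z : UnitAddCircle => z + (θ₀ : UnitAddCircle)) (𝓝 (ω : UnitAddCircle))
          (𝓝 ((Int.fract (ω + θ₀) : ℝ) : UnitAddCircle)) := by
        rw [coe_fract, AddCircle.coe_add]
        exact Continuous.tendsto (by fun_prop) _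
      filter_upwards [hc.eventually h1, hdc ω hω] with z hz hz2 ω' hω' hz'
      have h3 := hz _ (hτ ω' hω') (by rw [coe_fract, AddCircle.coe_add, hz'])
      rw [hrec ω hω, hrec ω' hω', hz2 ω' hω' hz', ← sub_div, add_sub_add_left_eq_sub, abs_div,
        abs_of_pos hd0, pow_succ, mul_one_div]
      gcongr
  have hEc : ∀ ω ∈ D, ∀ ε > 0, ∀ᶠ z in 𝓝 (ω : UnitAddCircle), ∀ ω' ∈ D,
      (ω' : UnitAddCircle) = z → |E ω' - E ω| ≤ ε := by
    intro ω hω ε hε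
    have hd2 : (2:ℝ) ≤ d := by exact_mod_cast hd
    obtain ⟨N, hN⟩ := exists_pow_lt_of_lt_one hε
      (show (1:ℝ) / d < 1 by rw [div_lt_one hd0]; linarith)
    filter_upwards [hEcN N ω hω] with z hz ω' hω' hz'
    exact (hz ω' hω' hz').trans hN.le
  -- the exceptional set
  have hC : (⋃ n : ℕ, ⋃ i : Fin (ℓ + 1), {s : ℝ | ((s + n * θ₀ : ℝ) : UnitAddCircle) =
      ((t i : ℝ) : UnitAddCircle)}).Countable := by
    refine countable_iUnion fun n => countable_iUnion fun i => ?_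
    apply (countable_range (fun j : ℤ => t i + j - n * θ₀)).mono
    intro s hs
    have hs' : Int.fract (s + n * θ₀) = Int.fract (t i) := (coe_eq_coe_iff_fract _ _).1 hs
    obtain ⟨j, hj⟩ := Int.fract_eq_fract.1 hs'
    exact ⟨j, by simp only; linarith⟩
  refine layer2 hθ hC ?_ hD1 hEI hEm hτ hET hEc T hTdef X hX
  intro s hs
  rw [hD]
  refine ⟨⟨Int.fract_nonneg _, (Int.fract_lt_one _).le⟩, ?_⟩
  intro n i h
  apply hs
  simp only [mem_iUnion]
  refine ⟨n, i, ?_⟩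
  change ((s + n * θ₀ : ℝ) : UnitAddCircle) = _
  rw [← h, coe_eq_coe_iff_fract, fract_fract_add]
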